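/- arXiv:2407.15744 — 2 statements merged into one kernel-verified Lean document; each statement's English description precedes it below -/
import Mathlib

section
/- (Adjustment criterion) Let G be a canonical acyclic directed mixed graph on V = {1, …, d}, and let β, Λ ∈ ℝ^{d×d} be compatible with G with Λ symmetric positive definite; set Σ = (I − β)^{-T} Λ (I − β)^{-1}. Let {j}, {k}, L ⊂ V be pairwise disjoint, Ṽ = {j, k} ∪ L, Σ̃ = Σ_{Ṽ,Ṽ}, and γ = −((Σ̃^{-1})_{jk}) / ((Σ̃^{-1})_{kk}). Suppose: (1) every path from j to k in G that is not ancestrally blocked by L is a right-directed path; (2) there is no right-directed walk from k to any member of L in G; and (3) there is no vertex l ∉ Ṽ such that some right-directed walk from j to k passing through l is not blocked by L and some right-directed walk goes from l to a member of L. Then γ equals the sum, over all right-directed paths from j to k in G that are not blocked by L, of the product of β over their edges. -/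
/-! ### Walks on directed mixed graphs -/

/-- How an edge is traversed by a walk. -/
inductive EKind : Type
  | fwd   -- a directed edge traversed forwards:  `a → b`
  | bwd   -- a directed edge traversed backwards: `a ← b` (the edge is `b → a`)
  | bidir -- a bidirected edge: `a ↔ b`
  deriving DecidableEq

/-- A directed mixed graph on vertex type `V` (directed edges `dir`, bidirected
edges `bi`; loops are allowed). -/
structure MixedGraph (V : Type*) where
  dir : V → V → Prop
  bi : V → V → Prop

/-- A candidate walk: a starting vertex together with a list of steps; each step
records how the next edge is traversed and the next vertex reached. -/
structure MWalk (V : Type*) where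
  head : V
  tail : List (EKind × V)

namespace MWalk

variable {V : Type*}

/-- The last vertex of a walk. -/
def last (w : MWalk V) : V := (w.tail.map Prod.snd).getLastD w.head

/-- The list of vertex occurrences of a walk. -/
def verts (w : MWalk V) : List V := w.head :: w.tail.map Prod.snd

/-- The length (number of edge-traversals) of a walk. -/
def length (w : MWalk V) : ℕ := w.tail.length

/-- The non-endpoint (interior) vertex occurrences of a walk. -/
def interior (w : MWalk V) : List V := (w.tail.map Prod.snd).dropLast

/-- Does this kind of traversal have an arrowhead at its end vertex? -/
def arrowAtEnd : EKind → Bool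
  | .fwd => true
  | .bwd => false
  | .bidir => true

/-- Does this kind of traversal have an arrowhead at its start vertex? -/
def arrowAtStart : EKind → Bool
  | .fwd => false
  | .bwd => true
  | .bidir => true

/-- The interior vertex occurrence reached by step `i` (present when
`i + 1 < w.tail.length`) is a collider. -/
def ColliderAt (w : MWalk V) (i : ℕ) : Prop :=
  ∃ s t : EKind × V, w.tail[i]? = some s ∧ w.tail[i + 1]? = some t ∧
    arrowAtEnd s.1 = true ∧ arrowAtStart t.1 = true

/-- The walk contains no collider. -/
def NoCollider (w : MWalk V) : Prop := ∀ i, ¬ w.ColliderAt i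

/-- Validity in `G` of a list of steps starting at a given vertex. -/
def Valid (G : MixedGraph V) : V → List (EKind × V) → Prop
  | _, [] => True
  | a, s :: rest =>
      (match s.1 with
        | EKind.fwd => G.dir a s.2
        | EKind.bwd => G.dir s.2 a
        | EKind.bidir => G.bi a s.2) ∧ Valid G s.2 rest

/-- `w` is a walk (with at least one edge) in `G`. -/
def IsWalk (G : MixedGraph V) (w : MWalk V) : Prop := w.tail ≠ [] ∧ Valid G w.head w.tail

/-- `w` is a walk in `G` from `j` to `k`. -/
def IsWalkFrom (G : MixedGraph V) (w : MWalk V) (j k : V) : Prop :=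
  IsWalk G w ∧ w.head = j ∧ w.last = k

/-- A right-directed walk: all directed edges traversed forwards. -/
def IsRightDirected (w : MWalk V) : Prop := ∀ s ∈ w.tail, s.1 = EKind.fwd

/-- A left-directed walk: all directed edges traversed backwards. -/
def IsLeftDirected (w : MWalk V) : Prop := ∀ s ∈ w.tail, s.1 = EKind.bwd

/-- A walk using only directed edges (traversed in either direction). -/
def DirectedOnly (w : MWalk V) : Prop := ∀ s ∈ w.tail, s.1 ≠ EKind.bidir

/-- A trek: a (possibly empty) left leg of directed edges traversed backwards,
then exactly one bidirected edge, then a (possibly empty) right leg of directed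
edges traversed forwards. -/
def IsTrek (w : MWalk V) : Prop :=
  ∃ (l : List (EKind × V)) (b : EKind × V) (r : List (EKind × V)),
    w.tail = l ++ b :: r ∧ (∀ s ∈ l, s.1 = EKind.bwd) ∧ b.1 = EKind.bidir ∧
      (∀ s ∈ r, s.1 = EKind.fwd)

/-- A d-connected walk: directed edges traversed backwards followed by directed
edges traversed forwards, at least one edge in total. -/
def IsDConnWalk (w : MWalk V) : Prop :=
  w.tail ≠ [] ∧ ∃ l r : List (EKind × V), w.tail = l ++ r ∧
    (∀ s ∈ l, s.1 = EKind.bwd) ∧ (∀ s ∈ r, s.1 = EKind.fwd)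

/-- An arc (m-connected walk): a trek or a d-connected walk. -/
def IsArc (w : MWalk V) : Prop := IsTrek w ∨ IsDConnWalk w

/-- A path: a walk visiting no vertex more than once. -/
def IsPath (w : MWalk V) : Prop := w.verts.Nodup

/-- The number of bidirected edges traversed by the walk. -/
def bidirCount (w : MWalk V) : ℕ := w.tail.countP (fun s => decide (s.1 = EKind.bidir))

/-- `w` is blocked by `L`: some collider on it lies outside `L`, or some
non-collider non-endpoint on it lies in `L`. -/
def Blocked (w : MWalk V) (L : Set V) : Prop :=
  ∃ (i : ℕ) (v : V), i + 1 < w.tail.length ∧ (w.tail[i]?).map Prod.snd = some v ∧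
    ((w.ColliderAt i ∧ v ∉ L) ∨ (¬ w.ColliderAt i ∧ v ∈ L))

/-- A collider-connected walk: all non-endpoints are colliders. -/
def IsColliderConnected (w : MWalk V) : Prop := ∀ i, i + 1 < w.tail.length → w.ColliderAt i

/-- The weight of a list of steps starting from a given vertex: `β l m` for a
traversal (in either direction) of the directed edge `l → m` and `Λ l m` for a
traversal of the bidirected edge `l ↔ m`. -/
def weightFrom (β Λ : V → V → ℝ) : V → List (EKind × V) → ℝ
  | _, [] => 1
  | a, s :: rest =>
      (match s.1 with
        | EKind.fwd => β a s.2
        | EKind.bwd => β s.2 a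
        | EKind.bidir => Λ a s.2) * weightFrom β Λ s.2 rest

/-- The weight of a walk. -/
def weight (β Λ : V → V → ℝ) (w : MWalk V) : ℝ := weightFrom β Λ w.head w.tail

end MWalk

namespace MixedGraph

variable {V : Type*}

/-- The bidirected edge relation is symmetric. -/
def BiSymm (G : MixedGraph V) : Prop := ∀ j k, G.bi j k → G.bi k j

/-- Canonical: every vertex carries a bidirected loop. -/
def Canonical (G : MixedGraph V) : Prop := ∀ v, G.bi v v

/-- Canonically directed: the bidirected edges are exactly the loops. -/
def CanonicallyDirected (G : MixedGraph V) : Prop := ∀ j k, G.bi j k ↔ j = k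

/-- There is a right-directed walk from `j` to `k` in `G`. -/
def RDConn (G : MixedGraph V) (j k : V) : Prop :=
  ∃ w : MWalk V, MWalk.IsWalkFrom G w j k ∧ w.IsRightDirected

/-- Acyclicity: no right-directed walk from a vertex to itself. -/
def Acyclic (G : MixedGraph V) : Prop := ∀ v, ¬ G.RDConn v v

/-- Remove all bidirected loops. -/
def trim (G : MixedGraph V) : MixedGraph V where
  dir := G.dir
  bi j k := G.bi j k ∧ j ≠ k

/-- m-connection given `L`: some walk from `j` to `k` is not blocked by `L`. -/
def MConn (G : MixedGraph V) (j k : V) (L : Set V) : Prop :=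
  ∃ w : MWalk V, MWalk.IsWalkFrom G w j k ∧ ¬ w.Blocked L

/-- d-connection given `L`: some walk from `j` to `k` using only directed edges
is not blocked by `L`. -/
def DConn (G : MixedGraph V) (j k : V) (L : Set V) : Prop :=
  ∃ w : MWalk V, MWalk.IsWalkFrom G w j k ∧ w.DirectedOnly ∧ ¬ w.Blocked L

/-- `w` is ancestrally blocked by `L`: it contains a collider `v ∉ L` with no
right-directed walk from `v` to a member of `L`, or a non-collider non-endpoint
in `L`. -/
def AncBlocked (G : MixedGraph V) (w : MWalk V) (L : Set V) : Prop :=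
  ∃ (i : ℕ) (v : V), i + 1 < w.tail.length ∧ (w.tail[i]?).map Prod.snd = some v ∧
    ((w.ColliderAt i ∧ v ∉ L ∧ ¬ ∃ l ∈ L, G.RDConn v l) ∨ (¬ w.ColliderAt i ∧ v ∈ L))

/-- The marginal graph (latent projection) of `G` on `T`. -/
def marg (G : MixedGraph V) (T : Set V) : MixedGraph V where
  dir j k := j ∈ T ∧ k ∈ T ∧ ∃ w : MWalk V, MWalk.IsWalkFrom G w j k ∧
      w.IsRightDirected ∧ ∀ v ∈ w.interior, v ∉ T
  bi j k := j ∈ T ∧ k ∈ T ∧ ∃ w : MWalk V, MWalk.IsWalkFrom G w j k ∧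
      w.IsTrek ∧ ∀ v ∈ w.interior, v ∉ T

/-- t-connection given `L`: a concatenation of treks, each not blocked by `L`,
with consecutive treks meeting at vertices belonging to `L`. -/
inductive TConn (G : MixedGraph V) (L : Set V) : V → V → Prop
  | single {j k : V} (w : MWalk V) (hw : MWalk.IsWalkFrom G w j k) (ht : w.IsTrek)
      (hb : ¬ w.Blocked L) : TConn G L j k
  | cons {j m k : V} (w : MWalk V) (hw : MWalk.IsWalkFrom G w j m) (ht : w.IsTrek)
      (hb : ¬ w.Blocked L) (hm : m ∈ L) (h : TConn G L m k) : TConn G L j k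

end MixedGraph

namespace AdjCrit

open MWalk Relation

variable {V : Type*}

/-- Reachability of a member of `L` by a possibly trivial directed walk. -/
def AL (G : MixedGraph V) (L : Set V) (v : V) : Prop := ∃ m ∈ L, ReflTransGen G.dir v m

/-- Recursive openness of a list of steps; the flag says whether we arrived with an arrowhead. -/
def OpenT (G : MixedGraph V) (L : Set V) : Bool → V → List (EKind × V) → Prop
  | _, _, [] => True
  | b, a, s :: rest =>
      ((b = true ∧ arrowAtStart s.1 = true → AL G L a) ∧
        (¬ (b = true ∧ arrowAtStart s.1 = true) → a ∉ L)) ∧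
      OpenT G L (arrowAtEnd s.1) s.2 rest

/-- End vertex. -/
def lst (a : V) (l : List (EKind × V)) : V := (l.map Prod.snd).getLastD a

@[simp] theorem lst_nil (a : V) : lst a [] = a := rfl
@[simp] theorem lst_cons (a : V) (s : EKind × V) (l) : lst a (s :: l) = lst s.2 l := by
  simp only [lst, List.map_cons, List.getLastD_cons]

theorem lst_append (a : V) (l : List (EKind × V)) (s : EKind × V) (r) :
    lst a (l ++ s :: r) = lst s.2 r := by
  induction l generalizing a with
  | nil => simp
  | cons t l ih => simp [ih]

theorem valid_append {G : MixedGraph V} (a : V) (l : List (EKind × V)) (s : EKind × V) (r) :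
    Valid G a (l ++ s :: r) ↔ Valid G a (l ++ [s]) ∧ Valid G s.2 r := by
  induction l generalizing a with
  | nil => simp [Valid]
  | cons t l ih =>
    simp only [List.cons_append, Valid]
    rw [ih]
    tauto

theorem openT_append {G : MixedGraph V} {L : Set V} (b : Bool) (a : V)
    (l : List (EKind × V)) (s : EKind × V) (r) :
    OpenT G L b a (l ++ s :: r) ↔ OpenT G L b a (l ++ [s]) ∧ OpenT G L (arrowAtEnd s.1) s.2 r := by
  induction l generalizing a b with
  | nil => simp [OpenT]
  | cons t l ih =>
    simp only [List.cons_append, OpenT]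
    rw [ih]
    tauto

theorem valid_fwd {G : MixedGraph V} (a : V) (v : V) (r) :
    Valid G a ((EKind.fwd, v) :: r) ↔ G.dir a v ∧ Valid G v r := Iff.rfl
theorem valid_bwd {G : MixedGraph V} (a : V) (v : V) (r) :
    Valid G a ((EKind.bwd, v) :: r) ↔ G.dir v a ∧ Valid G v r := Iff.rfl
theorem valid_bidir {G : MixedGraph V} (a : V) (v : V) (r) :
    Valid G a ((EKind.bidir, v) :: r) ↔ G.bi a v ∧ Valid G v r := Iff.rfl

theorem AL_head {G : MixedGraph V} {L : Set V} {a b : V} (h : G.dir a b) (hb : AL G L b) :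
    AL G L a := by
  obtain ⟨m, hm, h2⟩ := hb
  exact ⟨m, hm, ReflTransGen.head h h2⟩

theorem rdconn_of_transGen {G : MixedGraph V} {a b : V} (h : TransGen G.dir a b) :
    G.RDConn a b := by
  induction h using TransGen.head_induction_on with
  | single h =>
    exact ⟨⟨_, [(EKind.fwd, b)]⟩, ⟨⟨by simp, h, trivial⟩, rfl, rfl⟩, by
      intro s hs; simp at hs; simp [hs]⟩
  | @head a c h _ ih =>
    obtain ⟨⟨x, l⟩, ⟨⟨hne, hv⟩, hx, hl⟩, hr⟩ := ih
    simp only at hx hv hne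
    subst hx
    refine ⟨⟨a, (EKind.fwd, x) :: l⟩, ⟨⟨by simp, h, hv⟩, rfl, ?_⟩, ?_⟩
    · change lst a ((EKind.fwd, x) :: l) = b
      rw [lst_cons]; exact hl
    · intro s hs
      rcases List.mem_cons.1 hs with rfl | hs
      · rfl
      · exact hr s hs

theorem fwd_reach {G : MixedGraph V} {a : V} {l : List (EKind × V)} (hv : Valid G a l)
    (hf : ∀ s ∈ l, s.1 = EKind.fwd) : ∀ x ∈ l.map Prod.snd, TransGen G.dir a x := by
  induction l generalizing a with
  | nil => simp
  | cons s l ih =>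
    obtain ⟨e, v⟩ := s
    have he : e = EKind.fwd := hf (e, v) (by simp)
    subst he
    intro x hx
    rw [valid_fwd] at hv
    simp only [List.map_cons, List.mem_cons] at hx
    rcases hx with rfl | hx
    · exact TransGen.single hv.1
    · exact TransGen.head hv.1 (ih hv.2 (fun s hs => hf s (by simp [hs])) x hx)

theorem transGen_of_rdconn {G : MixedGraph V} {a b : V} (h : G.RDConn a b) :
    TransGen G.dir a b := by
  obtain ⟨⟨x, l⟩, ⟨⟨hne, hv⟩, hx, hl⟩, hr⟩ := h
  simp only at hx hv hne
  subst hx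
  apply fwd_reach hv hr
  have hne' : l.map Prod.snd ≠ [] := by simpa using hne
  have : b = (l.map Prod.snd).getLast hne' := by
    rw [← hl]
    simp only [MWalk.last]
    rw [List.getLastD_eq_getLast?, List.getLast?_eq_getLast_of_ne_nil hne']
    rfl
  rw [this]
  exact List.getLast_mem hne'

theorem acyc {G : MixedGraph V} (h : G.Acyclic) (v : V) : ¬ TransGen G.dir v v :=
  fun hh => h v (rdconn_of_transGen hh)

theorem fwd_nodup {G : MixedGraph V} (hac : G.Acyclic) {a : V} {l : List (EKind × V)}
    (hv : Valid G a l)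
    (hf : ∀ s ∈ l, s.1 = EKind.fwd) : (a :: l.map Prod.snd).Nodup := by
  induction l generalizing a with
  | nil => simp
  | cons s l ih =>
    rw [List.nodup_cons]
    refine ⟨fun hm => acyc hac a (fwd_reach hv hf a hm), ?_⟩
    exact ih hv.2 (fun s hs => hf s (by simp [hs]))

theorem colliderAt_succ (a b : V) (s : EKind × V) (l) (i : ℕ) :
    ColliderAt ⟨a, s :: l⟩ (i + 1) ↔ ColliderAt ⟨b, l⟩ i := by
  simp [ColliderAt]

theorem open_spec {G : MixedGraph V} {L : Set V} (b : Bool) (a : V) (l : List (EKind × V))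
    (h : OpenT G L b a l) (i : ℕ) (v : V) (hi : i + 1 < l.length)
    (hv : (l[i]?).map Prod.snd = some v) :
    (ColliderAt ⟨a, l⟩ i → AL G L v) ∧ (¬ ColliderAt ⟨a, l⟩ i → v ∉ L) := by
  induction l generalizing a b i with
  | nil => simp at hi
  | cons s l ih =>
    cases i with
    | zero =>
      cases l with
      | nil => simp at hi
      | cons t r =>
        simp at hv
        subst hv
        have hc : ColliderAt ⟨a, s :: t :: r⟩ 0 ↔ (arrowAtEnd s.1 = true ∧ arrowAtStart t.1 = true) := by
          simp [ColliderAt]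
        rw [hc]
        exact h.2.1
    | succ i =>
      rw [colliderAt_succ a s.2]
      exact ih _ _ h.2 i (by simpa using hi) (by simpa using hv)

theorem not_ancBlocked {G : MixedGraph V} {L : Set V} (b : Bool) (a : V) (l : List (EKind × V))
    (h : OpenT G L b a l) : ¬ G.AncBlocked ⟨a, l⟩ L := by
  rintro ⟨i, v, hi, hv, hh⟩
  have := open_spec b a l h i v hi hv
  rcases hh with ⟨hc, h1, h2⟩ | ⟨hc, h1⟩
  · obtain ⟨m, hm, hr⟩ := this.1 hc
    rcases reflTransGen_iff_eq_or_transGen.1 hr with rfl | hr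
    · exact h1 hm
    · exact h2 ⟨m, hm, rdconn_of_transGen hr⟩
  · exact this.2 hc h1

theorem no_collider_of_fwd (a : V) (l : List (EKind × V)) (hf : ∀ s ∈ l, s.1 = EKind.fwd) (i : ℕ) :
    ¬ ColliderAt ⟨a, l⟩ i := by
  rintro ⟨s, t, hs, ht, h1, h2⟩
  have := hf t (List.mem_of_getElem? ht)
  rw [this] at h2
  simp [arrowAtStart] at h2

theorem not_blocked_fwd {G : MixedGraph V} {L : Set V} (b : Bool) (a : V) (l : List (EKind × V))
    (h : OpenT G L b a l) (hf : ∀ s ∈ l, s.1 = EKind.fwd) : ¬ MWalk.Blocked ⟨a, l⟩ L := by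
  rintro ⟨i, v, hi, hv, hh⟩
  have := open_spec b a l h i v hi hv
  rcases hh with ⟨hc, h1⟩ | ⟨hc, h1⟩
  · exact no_collider_of_fwd a l hf i hc
  · exact this.2 hc h1

theorem open_loop {G : MixedGraph V} {L : Set V} (a : V) (l : List (EKind × V))
    (h : OpenT G L true a l) (hv : Valid G a l) (hf : ¬ ∀ s ∈ l, s.1 = EKind.fwd) : AL G L a := by
  induction l generalizing a with
  | nil => simp at hf
  | cons s l ih =>
    obtain ⟨e, v⟩ := s
    cases e with
    | fwd =>
      refine AL_head hv.1 (ih v h.2 hv.2 ?_)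
      intro hh
      apply hf
      intro s hs
      rcases List.mem_cons.1 hs with rfl | hs
      · rfl
      · exact hh s hs
    | bwd => exact h.1.1 ⟨rfl, rfl⟩
    | bidir => exact h.1.1 ⟨rfl, rfl⟩

theorem exists_dup (l : List (EKind × V)) (h : ¬ (l.map Prod.snd).Nodup) :
    ∃ l1 s1 l2 s2 l3, l = l1 ++ s1 :: (l2 ++ s2 :: l3) ∧ s1.2 = s2.2 := by
  induction l with
  | nil => simp at h
  | cons s l ih =>
    rw [List.map_cons, List.nodup_cons] at h
    by_cases hs : s.2 ∈ l.map Prod.snd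
    · obtain ⟨t, ht, hts⟩ := List.mem_map.1 hs
      obtain ⟨l2, l3, rfl⟩ := List.append_of_mem ht
      exact ⟨[], s, l2, t, l3, rfl, hts.symm⟩
    · obtain ⟨l1, s1, l2, s2, l3, rfl, h'⟩ := ih (fun hh => h ⟨hs, hh⟩)
      exact ⟨s :: l1, s1, l2, s2, l3, rfl, h'⟩

theorem lemmaA {d : ℕ} (G : MixedGraph (Fin d))
    (j k : Fin d) (L : Finset (Fin d)) (hkL : k ∉ L)
    (h1 : ∀ w : MWalk (Fin d), MWalk.IsWalkFrom G w j k → w.IsPath →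
      ¬ G.AncBlocked w (L : Set (Fin d)) → w.IsRightDirected)
    (h2 : ¬ ∃ l ∈ L, G.RDConn k l)
    (h3 : ¬ ∃ l : Fin d, l ∉ insert j (insert k L) ∧
      (∃ w : MWalk (Fin d), MWalk.IsWalkFrom G w j k ∧ w.IsRightDirected ∧
        ¬ w.Blocked (L : Set (Fin d)) ∧ l ∈ w.interior) ∧
      ∃ m ∈ L, G.RDConn l m) (n : ℕ) :
    ∀ l : List (EKind × Fin d), l.length = n → Valid G j l → lst j l = k →
      OpenT G (L : Set (Fin d)) false j l → j ∉ l.map Prod.snd →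
      (¬ ∀ s ∈ l, s.1 = EKind.fwd) → False := by
  have hk : ¬ AL G (L : Set (Fin d)) k := by
    rintro ⟨m, hm, hr⟩
    rcases reflTransGen_iff_eq_or_transGen.1 hr with rfl | hr
    · exact hkL hm
    · exact h2 ⟨m, hm, rdconn_of_transGen hr⟩
  induction n using Nat.strong_induction_on with
  | _ n ih =>
  intro l hn hv hl ho hj hf
  have hne : l ≠ [] := by rintro rfl; simp at hf
  by_cases hnd : (l.map Prod.snd).Nodup
  · exact hf (h1 ⟨j, l⟩ ⟨⟨hne, hv⟩, rfl, hl⟩ (List.nodup_cons.2 ⟨hj, hnd⟩) (not_ancBlocked _ _ _ ho))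
  · obtain ⟨l1, s1, l2, s2, l3, rfl, hs⟩ := exists_dup l hnd
    rw [valid_append, valid_append s1.2 l2] at hv
    rw [openT_append, openT_append _ s1.2 l2] at ho
    rw [lst_append, lst_append] at hl
    obtain ⟨hv1, hv2, hv3⟩ := hv
    obtain ⟨ho1, ho2, ho3⟩ := ho
    have hloop : arrowAtEnd s1.1 = true → (¬ ∀ s ∈ l2 ++ [s2], s.1 = EKind.fwd) →
        AL G (L : Set (Fin d)) s1.2 := by
      intro h hh
      rw [h] at ho2
      exact open_loop _ _ ho2 hv2 hh
    have ho' : OpenT G (L : Set (Fin d)) (arrowAtEnd s1.1) s1.2 l3 := by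
      cases l3 with
      | nil => trivial
      | cons t r =>
        refine ⟨⟨fun hh => ?_, fun hh => ?_⟩, ho3.2⟩
        · by_cases h2e : arrowAtEnd s2.1 = true
          · rw [hs]; exact ho3.1.1 ⟨h2e, hh.2⟩
          · apply hloop hh.1
            intro hall
            apply h2e
            rw [hall s2 (by simp)]; rfl
        · by_cases h2t : arrowAtStart t.1 = true
          · have hs1 : ¬ arrowAtEnd s1.1 = true := fun h => hh ⟨h, h2t⟩
            cases l2 with
            | nil => exact ho2.1.2 (fun h => hs1 h.1)
            | cons q l2 => exact ho2.1.2 (fun h => hs1 h.1)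
          · rw [hs]; exact ho3.1.2 (fun h => h2t h.2)
    have hvn : Valid G j (l1 ++ s1 :: l3) := by
      rw [valid_append]; exact ⟨hv1, by rw [hs]; exact hv3⟩
    have hon : OpenT G (L : Set (Fin d)) false j (l1 ++ s1 :: l3) := by
      rw [openT_append]; exact ⟨ho1, ho'⟩
    have hln : lst j (l1 ++ s1 :: l3) = k := by
      rw [lst_append, hs]; exact hl
    by_cases hfn : ∀ s ∈ l1 ++ s1 :: l3, s.1 = EKind.fwd
    · have hs1 : s1.1 = EKind.fwd := hfn s1 (by simp)
      have hal : AL G (L : Set (Fin d)) s1.2 := by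
        apply hloop (by rw [hs1]; rfl)
        intro hall
        apply hf
        intro s hs
        simp only [List.mem_append, List.mem_cons, List.not_mem_nil, or_false] at hs hall hfn
        rcases hs with h | h | h | h | h
        · exact hfn s (by tauto)
        · exact hfn s (by tauto)
        · exact hall s (by tauto)
        · exact hall s (by tauto)
        · exact hfn s (by tauto)
      have hsk : s1.2 ≠ k := fun h => hk (h ▸ hal)
      cases l3 with
      | nil => exact hsk (by rw [hs]; simpa using hl)
      | cons t r =>
        have ht : t.1 = EKind.fwd := hfn t (by simp)
        have hsL : s1.2 ∉ (L : Set (Fin d)) := by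
          apply ho'.1.2
          rw [ht]; simp [arrowAtStart]
        have hsj : s1.2 ≠ j := by
          intro h
          apply hj
          simp [h]
        apply h3
        refine ⟨s1.2, ?_, ⟨⟨j, l1 ++ s1 :: t :: r⟩, ⟨⟨by simp, hvn⟩, rfl, hln⟩, hfn,
          not_blocked_fwd _ _ _ hon hfn, ?_⟩, ?_⟩
        · simp only [Finset.mem_insert, not_or]
          exact ⟨hsj, hsk, by simpa using hsL⟩
        · simp [MWalk.interior, List.dropLast_append_of_ne_nil]
        · obtain ⟨m, hm, hr⟩ := hal
          rcases reflTransGen_iff_eq_or_transGen.1 hr with h | hr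
          · exact absurd (h ▸ hm) hsL
          · exact ⟨m, hm, rdconn_of_transGen hr⟩
    · refine ih _ ?_ (l1 ++ s1 :: l3) rfl hvn hln hon ?_ hfn
      · rw [← hn]; simp
      · intro h
        apply hj
        simp only [List.map_append, List.map_cons, List.mem_append, List.mem_cons] at h ⊢
        tauto

/-- Ancestors of `S`. -/
def WW (G : MixedGraph V) (S : Set V) : Set V := {a | AL G S a}

/-- Forward step lists from `u` to `k` avoiding `S`. -/
def TS (G : MixedGraph V) (S : Set V) (k u : V) : Set (List (EKind × V)) :=
  {l | Valid G u l ∧ lst u l = k ∧ ∀ s ∈ l, s.1 = EKind.fwd ∧ s.2 ∉ S}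

/-- Existence of an open walk to `k` starting with an arrowhead. -/
def TT (G : MixedGraph V) (L : Set V) (j k a : V) : Prop :=
  ∃ s rest, Valid G a (s :: rest) ∧ lst s.2 rest = k ∧ arrowAtStart s.1 = true ∧
    OpenT G L (arrowAtEnd s.1) s.2 rest ∧ j ∉ (s :: rest).map Prod.snd

theorem open_fwd {G : MixedGraph V} {L : Set V} (b : Bool) (a : V) (l : List (EKind × V))
    (ha : a ∉ L) (hl : ∀ s ∈ l, s.1 = EKind.fwd ∧ s.2 ∉ L) : OpenT G L b a l := by
  induction l generalizing b a with
  | nil => trivial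
  | cons s l ih =>
    have h := hl s (by simp)
    refine ⟨⟨fun hh => ?_, fun _ => ha⟩, ih _ _ h.2 (fun t ht => hl t (by simp [ht]))⟩
    rw [h.1] at hh
    simp [arrowAtStart] at hh

theorem separation {d : ℕ} (G : MixedGraph (Fin d)) (hsymm : G.BiSymm) (hcan : G.Canonical)
    (j k : Fin d) (L : Finset (Fin d)) (hjL : j ∉ L)
    (hA : ∀ l : List (EKind × Fin d), Valid G j l → lst j l = k →
      OpenT G (L : Set (Fin d)) false j l → j ∉ l.map Prod.snd →
      (¬ ∀ s ∈ l, s.1 = EKind.fwd) → False) :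
    ∃ N : Set (Fin d), j ∉ N ∧ N ⊆ WW G (insert j (L : Set (Fin d))) ∧
      (∀ a ∈ N, ∀ b ∈ WW G (insert j (L : Set (Fin d))), G.bi a b → b ∈ N) ∧
      (∀ a ∈ N, ∀ p, p ∉ L → G.dir p a → p ∈ N) ∧
      (∀ a ∈ N, a ∉ L → ∀ b ∈ WW G (insert j (L : Set (Fin d))), G.dir a b → b ∈ N) ∧
      (∀ u, u ∉ insert j (L : Set (Fin d)) → (TS G (insert j (L : Set (Fin d))) k u).Nonempty →
        ∀ a ∈ WW G (insert j (L : Set (Fin d))), G.bi u a → a ∈ N) := by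
  have hTj : ¬ TT G (L : Set (Fin d)) j k j := by
    rintro ⟨s, rest, hv, hl, hs, ho, hj⟩
    refine hA (s :: rest) hv (by simpa using hl) ⟨⟨fun h => by simp at h, fun _ => hjL⟩, ho⟩ hj ?_
    intro hall
    rw [hall s (by simp)] at hs
    simp [arrowAtStart] at hs
  have hne : ∀ a, TT G (L : Set (Fin d)) j k a → a ≠ j := fun a h e => hTj (e ▸ h)
  have hc : ∀ a b, TT G (L : Set (Fin d)) j k a → a ∉ L → G.dir a b →
      TT G (L : Set (Fin d)) j k b := by
    intro a b hT haL hab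
    have haj := hne a hT
    obtain ⟨s, rest, hv, hl, hs, ho, hj⟩ := hT
    refine ⟨(EKind.bwd, a), s :: rest, ⟨hab, hv⟩, by simpa using hl, rfl,
      ⟨⟨fun h => by simp [arrowAtEnd] at h, fun _ => haL⟩, ho⟩, ?_⟩
    rw [List.map_cons, List.mem_cons, not_or]
    exact ⟨haj.symm, hj⟩
  have hal : ∀ a ∈ WW G (insert j (L : Set (Fin d))), TT G (L : Set (Fin d)) j k a →
      AL G (L : Set (Fin d)) a := by
    intro a ha hT
    by_contra hna
    obtain ⟨m, hm, hr⟩ := ha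
    rcases hm with rfl | hm
    · apply hTj
      have : ∀ x, ReflTransGen G.dir a x → TT G (L : Set (Fin d)) m k x := by
        intro x hx
        induction hx with
        | refl => exact hT
        | @tail b c hab hbc ih => exact hc b c ih (fun hb => hna ⟨b, hb, hab⟩) hbc
      exact this m hr
    · exact hna ⟨m, hm, hr⟩
  have hWp : ∀ p a, a ∈ WW G (insert j (L : Set (Fin d))) → G.dir p a →
      p ∈ WW G (insert j (L : Set (Fin d))) := fun p a ha hp => AL_head hp ha
  refine ⟨{a | a ∈ WW G (insert j (L : Set (Fin d))) ∧ TT G (L : Set (Fin d)) j k a},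
    fun h => hTj h.2, fun a h => h.1, ?_, ?_, ?_, ?_⟩
  · rintro a ⟨haW, hT⟩ b hb hab
    refine ⟨hb, ?_⟩
    have haL := hal a haW hT
    have haj := hne a hT
    obtain ⟨s, rest, hv, hl, hs, ho, hj⟩ := hT
    refine ⟨(EKind.bidir, a), s :: rest, ⟨hsymm _ _ hab, hv⟩, by simpa using hl, rfl,
      ⟨⟨fun _ => haL, fun h => absurd ⟨rfl, hs⟩ h⟩, ho⟩, ?_⟩
    rw [List.map_cons, List.mem_cons, not_or]
    exact ⟨haj.symm, hj⟩
  · rintro a ⟨haW, hT⟩ p hp hpa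
    refine ⟨hWp p a haW hpa, ?_⟩
    have haL := hal a haW hT
    have haj := hne a hT
    obtain ⟨s, rest, hv, hl, hs, ho, hj⟩ := hT
    have ho' : OpenT G (L : Set (Fin d)) true a (s :: rest) :=
      ⟨⟨fun _ => haL, fun h => absurd ⟨rfl, hs⟩ h⟩, ho⟩
    have hj' : j ∉ ((EKind.fwd, a) :: s :: rest).map Prod.snd := by
      rw [List.map_cons, List.mem_cons, not_or]
      exact ⟨haj.symm, hj⟩
    have hpj : p ≠ j := by
      rintro rfl
      refine hA ((EKind.fwd, a) :: s :: rest) ⟨hpa, hv⟩ (by simpa using hl)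
        ⟨⟨fun h => by simp at h, fun _ => hjL⟩, ho'⟩ hj' ?_
      intro hall
      rw [hall s (by simp)] at hs
      simp [arrowAtStart] at hs
    refine ⟨(EKind.bidir, p), (EKind.fwd, a) :: s :: rest, ⟨hcan p, hpa, hv⟩, by simpa using hl, rfl,
      ⟨⟨fun h => by simp [arrowAtStart] at h, fun _ => hp⟩, ho'⟩, ?_⟩
    rw [List.map_cons, List.mem_cons, not_or]
    exact ⟨hpj.symm, hj'⟩
  · rintro a ⟨haW, hT⟩ haL b hb hab
    exact ⟨hb, hc a b hT haL hab⟩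
  · rintro u hu ⟨l, hv, hl, hf⟩ a ha hua
    refine ⟨ha, (EKind.bidir, u), l, ⟨hsymm _ _ hua, hv⟩, hl, rfl, ?_, ?_⟩
    · apply open_fwd
      · exact fun h => hu (Or.inr h)
      · exact fun s hs => ⟨(hf s hs).1, fun h => (hf s hs).2 (Or.inr h)⟩
    · rw [List.map_cons, List.mem_cons, not_or]
      refine ⟨fun h => hu (Or.inl h.symm), ?_⟩
      intro h
      obtain ⟨s, hs, hsj⟩ := List.mem_map.1 h
      exact (hf s hs).2 (Or.inl hsj)

/-- Total weight of forward walks from `u` to `k` avoiding `S`. -/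
noncomputable def tau (G : MixedGraph V) (β Λ : V → V → ℝ) (S : Set V) (k u : V) : ℝ :=
  ∑ᶠ l ∈ TS G S k u, weightFrom β Λ u l

theorem TS_eq (G : MixedGraph V) (S : Set V) (k u : V) :
    TS G S k u = {l | l = [] ∧ u = k} ∪
      ⋃ v ∈ {v | v ∉ S ∧ G.dir u v}, (fun l => (EKind.fwd, v) :: l) '' TS G S k v := by
  ext l
  cases l with
  | nil => simp [TS, Valid]
  | cons s l =>
    obtain ⟨e, v⟩ := s
    simp only [TS, Set.mem_ofPred_eq, Set.mem_union, Set.mem_iUnion, Set.mem_image]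
    constructor
    · rintro ⟨hv, hl, hf⟩
      right
      have := hf (e, v) (by simp)
      obtain rfl : e = EKind.fwd := this.1
      exact ⟨v, ⟨this.2, hv.1⟩, l, ⟨hv.2, by simpa using hl, fun s hs => hf s (by simp [hs])⟩, rfl⟩
    · rintro (h | ⟨v', ⟨hvS, hd⟩, l', ⟨hv, hl, hf⟩, heq⟩)
      · simp at h
      · simp only [List.cons.injEq, Prod.mk.injEq] at heq
        obtain ⟨⟨rfl, rfl⟩, rfl⟩ := heq
        refine ⟨⟨hd, hv⟩, by simpa using hl, ?_⟩
        intro s hs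
        rcases List.mem_cons.1 hs with rfl | hs
        · exact ⟨rfl, hvS⟩
        · exact hf s hs

theorem wf {d : ℕ} (G : MixedGraph (Fin d)) (hac : G.Acyclic) :
    WellFounded (fun a b => G.dir b a) := by
  have h : IsTrans (Fin d) (fun a b => TransGen G.dir b a) := ⟨fun a b c h1 h2 => h2.trans h1⟩
  have h' : Std.Irrefl (fun a b : Fin d => TransGen G.dir b a) := ⟨fun a => acyc hac a⟩
  have := Finite.wellFounded_of_trans_of_irrefl (fun a b : Fin d => TransGen G.dir b a)
  exact Subrelation.wf (fun h => TransGen.single h) this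

theorem TS_finite {d : ℕ} (G : MixedGraph (Fin d)) (hac : G.Acyclic) (S : Set (Fin d))
    (k u : Fin d) : (TS G S k u).Finite := by
  induction u using (wf G hac).induction with
  | _ u ih =>
  rw [TS_eq]
  refine Set.Finite.union ((Set.finite_singleton []).subset (fun l h => h.1)) ?_
  exact Set.Finite.biUnion (Set.toFinite _) (fun v hv => (ih v hv.2).image _)

open Classical in
theorem tau_rec {d : ℕ} (G : MixedGraph (Fin d)) (hac : G.Acyclic) (β Λ : Fin d → Fin d → ℝ)
    (hβ : ∀ a b, β a b ≠ 0 → G.dir a b) (S : Set (Fin d)) (k u : Fin d) :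
    tau G β Λ S k u = (if u = k then 1 else 0) +
      ∑ v, β u v * (if v ∈ S then 0 else tau G β Λ S k v) := by
  have hfin := TS_finite G hac S k
  have hfu : ∀ v, ((fun l => (EKind.fwd, v) :: l) '' TS G S k v).Finite := fun v => (hfin v).image _
  unfold tau
  rw [TS_eq, finsum_mem_union]
  · congr 1
    · by_cases h : u = k
      · rw [if_pos h]
        have : {l : List (EKind × Fin d) | l = [] ∧ u = k} = {[]} := by ext l; simp [h]
        rw [this, finsum_mem_singleton]; rfl
      · rw [if_neg h]
        have : {l : List (EKind × Fin d) | l = [] ∧ u = k} = ∅ := by ext l; simp [h]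
        rw [this, finsum_mem_empty]
    · rw [finsum_mem_biUnion]
      · rw [finsum_mem_def, finsum_eq_sum_of_fintype]
        refine Finset.sum_congr rfl (fun v _ => ?_)
        by_cases hvS : v ∈ S
        · simp [hvS]
        by_cases hd : G.dir u v
        · rw [Set.indicator_of_mem (show v ∈ {v | v ∉ S ∧ G.dir u v} from ⟨hvS, hd⟩), if_neg hvS]
          rw [finsum_mem_image (by intro a _ b _ h; simpa using h)]
          rw [mul_finsum_mem]
          rfl
        · rw [Set.indicator_of_notMem (fun h => hd h.2)]
          have : β u v = 0 := by
            by_contra h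
            exact hd (hβ _ _ h)
          simp [this]
      · intro a _ b _ hab
        apply Set.disjoint_left.2
        rintro l ⟨l1, _, rfl⟩ ⟨l2, _, h⟩
        simp at h
        exact hab h.1.symm
      · exact Set.toFinite _
      · exact fun v _ => hfu v
  · apply Set.disjoint_left.2
    rintro l ⟨rfl, _⟩ h
    simp at h
  · exact ((Set.finite_singleton []).subset (fun l h => h.1))
  · exact Set.Finite.biUnion (Set.toFinite _) (fun v _ => hfu v)

theorem tau_eq {d : ℕ} (G : MixedGraph (Fin d)) (hac : G.Acyclic) (β Λ : Fin d → Fin d → ℝ)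
    (j k : Fin d) (L : Finset (Fin d)) (hjk : j ≠ k) (hkL : k ∉ L) :
    ∑ᶠ w ∈ {w : MWalk (Fin d) | MWalk.IsWalkFrom G w j k ∧ w.IsRightDirected ∧
            w.IsPath ∧ ¬ w.Blocked (L : Set (Fin d))}, w.weight β Λ =
    tau G β Λ (insert j (L : Set (Fin d))) k j := by
  have hset : {w : MWalk (Fin d) | MWalk.IsWalkFrom G w j k ∧ w.IsRightDirected ∧
            w.IsPath ∧ ¬ w.Blocked (L : Set (Fin d))} =
      (fun l => (⟨j, l⟩ : MWalk (Fin d))) '' TS G (insert j (L : Set (Fin d))) k j := by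
    ext ⟨a, l⟩
    constructor
    · rintro ⟨⟨⟨hne, hv⟩, ha, hl⟩, hr, hp, hb⟩
      simp only at hne hv ha
      subst ha
      refine ⟨l, ⟨hv, hl, fun s hs => ⟨hr s hs, ?_⟩⟩, rfl⟩
      rintro (h | h)
      · exact acyc hac a (h ▸ fwd_reach hv hr s.2 (List.mem_map_of_mem hs))
      · obtain ⟨i, hi, his⟩ := List.getElem_of_mem hs
        by_cases hi1 : i + 1 < l.length
        · exact hb ⟨i, s.2, hi1, by simp [hi, his], Or.inr ⟨no_collider_of_fwd a l hr i, h⟩⟩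
        · have : s.2 = k := by
            obtain ⟨l1, r, hlr⟩ := List.append_of_mem hs
            have hl' : lst a l = k := hl
            have hne' : l ≠ [] := hne
            have e : l = l.dropLast ++ [l.getLast hne'] := (List.dropLast_append_getLast hne').symm
            have e2 : l.getLast hne' = s := by
              rw [List.getLast_eq_getElem, ← his]
              congr 1
              omega
            rw [e, lst_append, e2] at hl'
            simpa using hl'
          exact hkL (this ▸ h)
    · rintro ⟨l', ⟨hv, hl, hf⟩, heq⟩
      simp only [MWalk.mk.injEq] at heq
      obtain ⟨rfl, rfl⟩ := heq
      have hr : ∀ s ∈ l', s.1 = EKind.fwd := fun s hs => (hf s hs).1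
      refine ⟨⟨⟨?_, hv⟩, rfl, hl⟩, hr, fwd_nodup hac hv hr, ?_⟩
      · intro h
        simp only at h
        subst h
        exact hjk hl
      · rintro ⟨i, v, hi, hiv, h⟩
        rcases h with h | h
        · exact no_collider_of_fwd j l' hr i h.1
        · obtain ⟨s, hs, rfl⟩ := Option.map_eq_some_iff.1 hiv
          exact (hf s (List.mem_of_getElem? hs)).2 (Or.inr h.2)
  rw [hset, finsum_mem_image (by intro a _ b _ h; simpa using h)]
  rfl

open Matrix

theorem A_apply {d : ℕ} (β : Matrix (Fin d) (Fin d) ℝ) (e : Fin d → ℝ) (p : Fin d) :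
    ((1 - β) *ᵥ e) p = e p - ∑ a, β p a * e a := by
  rw [Matrix.sub_mulVec, Matrix.one_mulVec]
  rfl

theorem supp_lemma {d : ℕ} (G : MixedGraph (Fin d)) (hac : G.Acyclic)
    (β : Matrix (Fin d) (Fin d) ℝ) (hβ : ∀ a b, β a b ≠ 0 → G.dir a b) (W : Set (Fin d))
    (hW : ∀ p a, G.dir p a → a ∈ W → p ∈ W) (e : Fin d → ℝ)
    (hz : ∀ p, p ∉ W → ((1 - β) *ᵥ e) p = 0) (p : Fin d) : p ∉ W → e p = 0 := by
  induction p using (wf G hac).induction with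
  | _ p ih =>
  intro hp
  have h := hz p hp
  rw [A_apply] at h
  rw [sub_eq_zero.1 h]
  refine Finset.sum_eq_zero (fun a _ => ?_)
  by_cases hb : β p a = 0
  · simp [hb]
  · rw [ih a (hβ _ _ hb) (fun ha => hp (hW p a (hβ _ _ hb) ha)), mul_zero]

theorem A_unit {d : ℕ} (G : MixedGraph (Fin d)) (hac : G.Acyclic)
    (β : Matrix (Fin d) (Fin d) ℝ) (hβ : ∀ a b, β a b ≠ 0 → G.dir a b) : IsUnit (1 - β) := by
  rw [← Matrix.mulVec_injective_iff_isUnit]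
  intro x y hxy
  have hxy' : (1 - β) *ᵥ x = (1 - β) *ᵥ y := hxy
  have h0 : (1 - β) *ᵥ (x - y) = 0 := by rw [Matrix.mulVec_sub, hxy', sub_self]
  funext p
  have := supp_lemma G hac β hβ ∅ (by simp) (x - y) (fun p _ => by rw [h0]; rfl) p (by simp)
  simpa [sub_eq_zero] using this

theorem dual {d : ℕ} (Sm : Matrix (Fin d) (Fin d) ℝ) (T : Finset (Fin d)) (t : {x // x ∈ T})
    (M : Matrix {x // x ∈ T} {x // x ∈ T} ℝ)
    (hM : M = Sm.submatrix (fun a : {x // x ∈ T} => (a : Fin d)) (fun a : {x // x ∈ T} => (a : Fin d)))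
    (hu : IsUnit M) (q : Fin d → ℝ) (hq : q = fun s => if h : s ∈ T then M⁻¹ ⟨s, h⟩ t else 0) :
    ∀ s ∈ T, (Sm *ᵥ q) s = if s = t then 1 else 0 := by
  intro s hs
  have h1 : (Sm *ᵥ q) s = ∑ v ∈ T, Sm s v * q v := by
    symm
    apply Finset.sum_subset (Finset.subset_univ T)
    intro x _ hx
    rw [hq]; simp [hx]
  have h2 : (M * M⁻¹) ⟨s, hs⟩ t = if s = t then 1 else 0 := by
    rw [Matrix.mul_nonsing_inv _ ((Matrix.isUnit_iff_isUnit_det _).1 hu), Matrix.one_apply]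
    simp [Subtype.ext_iff]
  rw [h1, ← h2, Matrix.mul_apply, ← Finset.sum_coe_sort]
  refine Finset.sum_congr rfl (fun v _ => ?_)
  rw [hq, hM]
  simp

open Classical in
theorem linear_core {d : ℕ} (G : MixedGraph (Fin d)) (hac : G.Acyclic)
    (β Λ : Matrix (Fin d) (Fin d) ℝ)
    (hβc : ∀ a b, β a b ≠ 0 → G.dir a b) (hΛc : ∀ a b, Λ a b ≠ 0 → G.bi a b)
    (hpd : Λ.PosDef) (j k : Fin d) (L : Finset (Fin d)) (hjL : j ∉ L)
    (N : Set (Fin d)) (hjN : j ∉ N)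
    (hNa : ∀ a ∈ N, ∀ b ∈ WW G (insert j (L : Set (Fin d))), G.bi a b → b ∈ N)
    (hNb : ∀ a ∈ N, ∀ p, p ∉ L → G.dir p a → p ∈ N)
    (hNc : ∀ a ∈ N, a ∉ L → ∀ b ∈ WW G (insert j (L : Set (Fin d))), G.dir a b → b ∈ N)
    (hNd : ∀ u, u ∉ insert j (L : Set (Fin d)) → (TS G (insert j (L : Set (Fin d))) k u).Nonempty →
        ∀ a ∈ WW G (insert j (L : Set (Fin d))), G.bi u a → a ∈ N)
    (q : Fin d → ℝ) (hq0 : ∀ s, s ∉ insert j L → q s = 0)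
    (r : Fin d → ℝ)
    (hr : ∀ x : Fin d → ℝ, ((1 - β) *ᵥ x) ⬝ᵥ r = x ⬝ᵥ (Λ *ᵥ ((1 - β)⁻¹ *ᵥ q)))
    (hq1 : ∀ s ∈ insert j L, r s = if s = j then 1 else 0) :
    r k = tau G β Λ (insert j (L : Set (Fin d))) k j := by
  set W := WW G (insert j (L : Set (Fin d))) with hWdef
  set e := (1 - β)⁻¹ *ᵥ q with he
  have hAe : (1 - β) *ᵥ e = q := by
    rw [he, Matrix.mulVec_mulVec, Matrix.mul_nonsing_inv, Matrix.one_mulVec]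
    exact (Matrix.isUnit_iff_isUnit_det _).1 (A_unit G hac β hβc)
  have heW : ∀ p, p ∉ W → e p = 0 := by
    intro p
    apply supp_lemma G hac β hβc W (fun p a h ha => AL_head h ha)
    intro p hp
    rw [hAe]
    apply hq0
    intro h
    apply hp
    exact ⟨p, by simpa using h, ReflTransGen.refl⟩
  have hmemW : ∀ p, e p ≠ 0 → p ∈ W := fun p hp => by
    by_contra h
    exact hp (heW p h)
  set eN : Fin d → ℝ := fun a => if a ∈ N then e a else 0 with heN
  have hz : ∀ v, v ∉ L → ((1 - β) *ᵥ eN) v = 0 := by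
    intro v hv
    by_cases hvN : v ∈ N
    · have : ((1 - β) *ᵥ eN) v = ((1 - β) *ᵥ e) v := by
        rw [A_apply, A_apply]
        congr 1
        · simp [heN, hvN]
        · refine Finset.sum_congr rfl (fun a _ => ?_)
          by_cases hb : β v a = 0
          · simp [hb]
          by_cases hea : e a = 0
          · simp [heN, hea]
          have : a ∈ N := hNc v hvN hv a (hmemW a hea) (hβc _ _ hb)
          simp [heN, this]
      rw [this, hAe]
      apply hq0
      rw [Finset.mem_insert, not_or]
      exact ⟨fun h => hjN (h ▸ hvN), hv⟩
    · rw [A_apply]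
      have h1 : eN v = 0 := by simp [heN, hvN]
      rw [h1, zero_sub, neg_eq_zero]
      refine Finset.sum_eq_zero (fun a _ => ?_)
      by_cases hb : β v a = 0
      · simp [hb]
      by_cases haN : a ∈ N
      · exact absurd (hNb a haN v hv (hβc _ _ hb)) hvN
      · simp [heN, haN]
  have h0 : ((1 - β) *ᵥ eN) ⬝ᵥ r = 0 := by
    refine Finset.sum_eq_zero (fun v _ => ?_)
    by_cases hv : v ∈ L
    · rw [hq1 v (Finset.mem_insert_of_mem hv), if_neg, mul_zero]
      rintro rfl
      exact hjL hv
    · rw [hz v hv, zero_mul]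
  have h1 : eN ⬝ᵥ (Λ *ᵥ eN) = 0 := by
    rw [← h0, hr]
    refine Finset.sum_congr rfl (fun a _ => ?_)
    by_cases haN : a ∈ N
    · congr 1
      change ∑ b, Λ a b * eN b = ∑ b, Λ a b * e b
      refine Finset.sum_congr rfl (fun b _ => ?_)
      by_cases hl : Λ a b = 0
      · simp [hl]
      by_cases heb : e b = 0
      · simp [heN, heb]
      have : b ∈ N := hNa a haN b (hmemW b heb) (hΛc _ _ hl)
      simp [heN, this]
    · simp [heN, haN]
  have h2 : eN = 0 := by
    by_contra hne
    have := hpd.dotProduct_mulVec_pos hne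
    simp only [star_trivial] at this
    rw [h1] at this
    exact lt_irrefl _ this
  have hNe : ∀ a ∈ N, e a = 0 := by
    intro a ha
    have := congrFun h2 a
    simpa [heN, ha] using this
  set S : Set (Fin d) := insert j (L : Set (Fin d)) with hS
  set τ := tau G β Λ S k with hτ
  set τ' : Fin d → ℝ := fun u => if u ∈ S then 0 else τ u with hτ'
  have h3 : τ' ⬝ᵥ (Λ *ᵥ e) = 0 := by
    refine Finset.sum_eq_zero (fun u _ => ?_)
    by_cases huS : u ∈ S
    · simp [hτ', huS]
    by_cases hne : (TS G S k u).Nonempty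
    · have : (Λ *ᵥ e) u = 0 := by
        change ∑ a, Λ u a * e a = 0
        refine Finset.sum_eq_zero (fun a _ => ?_)
        by_cases hl : Λ u a = 0
        · simp [hl]
        by_cases hea : e a = 0
        · simp [hea]
        exact absurd (hNe a (hNd u huS hne a (hmemW a hea) (hΛc _ _ hl))) hea
      rw [this, mul_zero]
    · have h0 : τ u = 0 := by
        change ∑ᶠ l ∈ TS G S k u, weightFrom β Λ u l = 0
        rw [Set.not_nonempty_iff_eq_empty.1 hne, finsum_mem_empty]
      simp [hτ', h0]
  have h4 : ∀ v, ((1 - β) *ᵥ τ') v = (if v = k then 1 else 0) - if v ∈ S then τ v else 0 := by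
    intro v
    rw [A_apply]
    have := tau_rec G hac β Λ hβc S k v
    have h5 : ∑ a, β v a * τ' a = τ v - if v = k then 1 else 0 := by
      rw [hτ, this]; simp [hτ', hτ]
    rw [h5]
    by_cases hv : v ∈ S <;> simp [hτ', hv]
  have h5 := hr τ'
  rw [h3] at h5
  have h6 : ((1 - β) *ᵥ τ') ⬝ᵥ r = r k - τ j := by
    have : ∀ v, ((1 - β) *ᵥ τ') v * r v =
        (if v = k then r v else 0) - (if v = j then τ v else 0) := by
      intro v
      rw [h4, sub_mul]
      congr 1
      · simp
      · by_cases hv : v ∈ S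
        · rw [if_pos hv, hq1 v (by simpa [hS] using hv)]
          simp
        · have : v ≠ j := by
            rintro rfl
            exact hv (by simp [hS])
          simp [hv, this]
    unfold dotProduct
    rw [Finset.sum_congr rfl (fun v _ => this v), Finset.sum_sub_distrib]
    simp
  rw [h6] at h5
  linarith

end AdjCrit

open Matrix in
/-- The adjustment criterion: if (1) every path from `j` to `k` in `G` not
ancestrally blocked by `L` is right-directed, (2) `L` contains no descendant
of `k`, and (3) `L` contains no descendant of a non-endpoint of an unblocked
directed walk from `j` to `k`, then the population regression coefficient
`γ = -(Σ̃⁻¹)_{jk} / (Σ̃⁻¹)_{kk}` equals the total weight of right-directed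
paths from `j` to `k` not blocked by `L`. -/
theorem adjustment_criterion (d : ℕ) (G : MixedGraph (Fin d))
    (hsymm : G.BiSymm) (hcan : G.Canonical) (hacy : G.Acyclic)
    (β Λ : Matrix (Fin d) (Fin d) ℝ)
    (hβc : ∀ a b, β a b ≠ 0 → G.dir a b) (hΛc : ∀ a b, Λ a b ≠ 0 → G.bi a b)
    (hΛsym : Λ.IsSymm) (hpd : Λ.PosDef)
    (j k : Fin d) (L : Finset (Fin d))
    (hjk : j ≠ k) (hjL : j ∉ L) (hkL : k ∉ L)
    (h1 : ∀ w : MWalk (Fin d), MWalk.IsWalkFrom G w j k → w.IsPath →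
      ¬ G.AncBlocked w (L : Set (Fin d)) → w.IsRightDirected)
    (h2 : ¬ ∃ l ∈ L, G.RDConn k l)
    (h3 : ¬ ∃ l : Fin d, l ∉ insert j (insert k L) ∧
      (∃ w : MWalk (Fin d), MWalk.IsWalkFrom G w j k ∧ w.IsRightDirected ∧
        ¬ w.Blocked (L : Set (Fin d)) ∧ l ∈ w.interior) ∧
      ∃ m ∈ L, G.RDConn l m) :
    ∀ Sm : Matrix (Fin d) (Fin d) ℝ, Sm = ((1 - β)⁻¹)ᵀ * Λ * (1 - β)⁻¹ →
      ∀ St : Matrix {x // x ∈ insert j (insert k L)}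
          {x // x ∈ insert j (insert k L)} ℝ,
        St = Sm.submatrix (fun a : {x // x ∈ insert j (insert k L)} => (a : Fin d))
            (fun a : {x // x ∈ insert j (insert k L)} => (a : Fin d)) →
        -(St⁻¹ ⟨j, Finset.mem_insert_self j (insert k L)⟩
            ⟨k, Finset.mem_insert_of_mem (Finset.mem_insert_self k L)⟩) /
          (St⁻¹ ⟨k, Finset.mem_insert_of_mem (Finset.mem_insert_self k L)⟩
            ⟨k, Finset.mem_insert_of_mem (Finset.mem_insert_self k L)⟩) =
        ∑ᶠ w ∈ {w : MWalk (Fin d) | MWalk.IsWalkFrom G w j k ∧ w.IsRightDirected ∧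
            w.IsPath ∧ ¬ w.Blocked (L : Set (Fin d))},
          w.weight (fun a b => β a b) (fun a b => Λ a b) := by
  classical
  intro Sm hSm St hSt
  have hA := AdjCrit.A_unit G hacy β hβc
  have hdet := (Matrix.isUnit_iff_isUnit_det _).1 hA
  have hAinv : IsUnit (1 - β)⁻¹ := by
    rw [Matrix.isUnit_nonsing_inv_iff]; exact hA
  have hSpd : Sm.PosDef := by
    rw [hSm, ← Matrix.conjTranspose_eq_transpose_of_trivial]
    exact hpd.conjTranspose_mul_mul_same (Matrix.mulVec_injective_iff_isUnit.2 hAinv)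
  have hSsym : Smᵀ = Sm := by
    have := hSpd.isHermitian
    rwa [Matrix.IsHermitian, Matrix.conjTranspose_eq_transpose_of_trivial] at this
  have hlem := AdjCrit.lemmaA G j k L hkL h1 h2 h3
  obtain ⟨N, hjN, -, hNa, hNb, hNc, hNd⟩ := AdjCrit.separation G hsymm hcan j k L hjL
    (fun l => hlem l.length l rfl)
  have hsub : ∀ T : Finset (Fin d), (Sm.submatrix (fun a : {x // x ∈ T} => (a : Fin d))
      (fun a : {x // x ∈ T} => (a : Fin d))).PosDef :=
    fun T => hSpd.submatrix Subtype.val_injective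
  -- dual vector of `j` relative to `insert j L`
  obtain ⟨q, hq0, hq1⟩ : ∃ q : Fin d → ℝ, (∀ s, s ∉ insert j L → q s = 0) ∧
      ∀ s ∈ insert j L, (Sm *ᵥ q) s = if s = j then 1 else 0 := by
    refine ⟨_, ?_, AdjCrit.dual Sm (insert j L) ⟨j, Finset.mem_insert_self j L⟩ _ rfl
      (hsub _).isUnit _ rfl⟩
    intro s hs
    exact dif_neg hs
  have hτ := AdjCrit.linear_core G hacy β Λ hβc hΛc hpd j k L hjL N hjN hNa hNb hNc hNd q hq0
    (Sm *ᵥ q) (by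
      intro x
      rw [hSm, ← Matrix.mulVec_mulVec, ← Matrix.mulVec_mulVec, Matrix.dotProduct_mulVec,
        Matrix.vecMul_transpose, Matrix.mulVec_mulVec, Matrix.nonsing_inv_mul _ hdet,
        Matrix.one_mulVec]) hq1
  have hStpd : St.PosDef := by rw [hSt]; exact hsub _
  set kk : {x // x ∈ insert j (insert k L)} :=
    ⟨k, Finset.mem_insert_of_mem (Finset.mem_insert_self k L)⟩ with hkk
  set jj : {x // x ∈ insert j (insert k L)} := ⟨j, Finset.mem_insert_self j (insert k L)⟩ with hjj
  have hg1 := AdjCrit.dual Sm (insert j (insert k L)) kk St hSt hStpd.isUnit _ rfl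
  set g : Fin d → ℝ := fun s => if h : s ∈ insert j (insert k L) then St⁻¹ ⟨s, h⟩ kk else 0 with hg
  have hgk : g k = St⁻¹ kk kk := by simp [hg, hkk]
  have hgj : g j = St⁻¹ jj kk := by simp [hg, hjj]
  have hpos : 0 < St⁻¹ kk kk := hStpd.inv.diag_pos
  rw [AdjCrit.tau_eq G hacy (fun a b => β a b) (fun a b => Λ a b) j k L hjk hkL]
  change _ = AdjCrit.tau G β Λ (insert j (L : Set (Fin d))) k j
  rw [← hτ]
  have e1 : g ⬝ᵥ (Sm *ᵥ q) = g j + g k * (Sm *ᵥ q) k := by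
    have : ∀ v, g v * (Sm *ᵥ q) v = (if v = j then g v else 0) +
        (if v = k then g v * (Sm *ᵥ q) v else 0) := by
      intro v
      by_cases hv1 : v = j
      · subst hv1
        rw [hq1 v (Finset.mem_insert_self v L)]
        simp [hjk]
      by_cases hv2 : v = k
      · simp [hv1, hv2, Ne.symm hjk]
      by_cases hvL : v ∈ L
      · rw [hq1 v (Finset.mem_insert_of_mem hvL)]
        simp [hv1, hv2]
      · have : g v = 0 := by simp [hg, hv1, hv2, hvL]
        simp [this]
    unfold dotProduct
    rw [Finset.sum_congr rfl (fun v _ => this v), Finset.sum_add_distrib]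
    simp
  have e2 : g ⬝ᵥ (Sm *ᵥ q) = 0 := by
    rw [Matrix.dotProduct_mulVec, ← Matrix.mulVec_transpose, hSsym]
    refine Finset.sum_eq_zero (fun v _ => ?_)
    by_cases hv : v ∈ insert j L
    · rw [hg1 v (by rw [Finset.mem_insert] at hv ⊢; rw [Finset.mem_insert]; tauto), if_neg, zero_mul]
      rintro rfl
      rw [Finset.mem_insert] at hv
      rcases hv with h | h
      · exact hjk h.symm
      · exact hkL h
    · rw [hq0 v hv, mul_zero]
  rw [div_eq_iff hpos.ne', ← hgj, ← hgk]
  linarith [mul_comm (g k) ((Sm *ᵥ q) k)]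
end

section
/- (Augmentation criterion for m-separation) Let G be a canonical directed mixed graph and J, K, L ⊂ V pairwise disjoint. Let Ṽ be the ancestral closure of J ∪ K ∪ L, i.e., Ṽ = (J ∪ K ∪ L) ∪ { v ∈ V : there is a right-directed walk from v to some member of J ∪ K ∪ L }. Then there exist j ∈ J, k ∈ K with j mconn k | L in G if and only if, in the augmented undirected graph aug(marg_Ṽ(G)), there is a path from some vertex of J to some vertex of K none of whose non-endpoints lies in L. -/
/-- Adjacency in the augmented (moralized) undirected graph of `H`: distinct
vertices joined by a collider-connected walk. -/
def augAdj {V : Type*} (H : MixedGraph V) (j k : V) : Prop :=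
  j ≠ k ∧ ∃ w : MWalk V, MWalk.IsWalkFrom H w j k ∧ w.IsColliderConnected


section AugHelpers

variable {V : Type*}

open MWalk

def Ed (G : MixedGraph V) (a : V) (e : EKind) (u : V) : Prop :=
  match e with
  | EKind.fwd => G.dir a u
  | EKind.bwd => G.dir u a
  | EKind.bidir => G.bi a u

theorem valid_cons (G : MixedGraph V) (a : V) (s : EKind × V) (r : List (EKind × V)) :
    Valid G a (s :: r) ↔ Ed G a s.1 s.2 ∧ Valid G s.2 r := Iff.rfl

theorem last_cons (a : V) (s : EKind × V) (r : List (EKind × V)) :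
    last ⟨a, s :: r⟩ = last ⟨s.2, r⟩ := by
  simp only [last, List.map_cons, List.getLastD_cons]

theorem last_nil (a : V) : last (⟨a, []⟩ : MWalk V) = a := rfl

theorem colliderAt_zero (a : V) (s t : EKind × V) (r : List (EKind × V)) :
    ColliderAt ⟨a, s :: t :: r⟩ 0 ↔ arrowAtEnd s.1 = true ∧ arrowAtStart t.1 = true := by
  simp [ColliderAt]

theorem colliderAt_succ (a : V) (s : EKind × V) (r : List (EKind × V)) (i : ℕ) :
    ColliderAt ⟨a, s :: r⟩ (i + 1) ↔ ColliderAt ⟨s.2, r⟩ i := by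
  simp [ColliderAt]

theorem cc_single (a : V) (s : EKind × V) : IsColliderConnected ⟨a, [s]⟩ := by
  intro i hi
  simp at hi

theorem cc_cons (a : V) (s t : EKind × V) (r : List (EKind × V)) :
    IsColliderConnected ⟨a, s :: t :: r⟩ ↔
      (arrowAtEnd s.1 = true ∧ arrowAtStart t.1 = true) ∧
        IsColliderConnected ⟨s.2, t :: r⟩ := by
  constructor
  · intro h
    refine ⟨(colliderAt_zero a s t r).1 (h 0 (by simp)), fun i hi => ?_⟩
    exact (colliderAt_succ a s (t :: r) i).1 (h (i + 1) (by simpa using hi))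
  · rintro ⟨h0, h⟩ i hi
    cases i with
    | zero => exact (colliderAt_zero a s t r).2 h0
    | succ i => exact (colliderAt_succ a s (t :: r) i).2 (h i (by simpa using hi))

theorem nb_single (a : V) (s : EKind × V) (L : Set V) : ¬ Blocked ⟨a, [s]⟩ L := by
  rintro ⟨i, v, hi, _⟩
  simp at hi

theorem nb_cons (a : V) (s t : EKind × V) (r : List (EKind × V)) (L : Set V) :
    ¬ Blocked ⟨a, s :: t :: r⟩ L ↔
      ((arrowAtEnd s.1 && arrowAtStart t.1) = true ↔ s.2 ∈ L) ∧
        ¬ Blocked ⟨s.2, t :: r⟩ L := by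
  have h0 := colliderAt_zero a s t r
  rw [Bool.and_eq_true, ← h0]
  constructor
  · intro h
    refine ⟨⟨fun hc => ?_, fun hL => ?_⟩, ?_⟩
    · by_contra hn
      exact h ⟨0, s.2, by simp, by simp, Or.inl ⟨hc, hn⟩⟩
    · by_contra hn
      exact h ⟨0, s.2, by simp, by simp, Or.inr ⟨hn, hL⟩⟩
    · rintro ⟨i, v, hi, hv, hc⟩
      refine h ⟨i + 1, v, by simpa using hi, by simpa using hv, ?_⟩
      rwa [colliderAt_succ]
  · rintro ⟨h1, h2⟩ ⟨i, v, hi, hv, hc⟩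
    cases i with
    | zero =>
      simp at hv
      subst hv
      tauto
    | succ i =>
      refine h2 ⟨i, v, by simpa using hi, by simpa using hv, ?_⟩
      rwa [colliderAt_succ] at hc

theorem rtg_of_fwd (G : MixedGraph V) : ∀ (r : List (EKind × V)) (a : V),
    Valid G a r → (∀ s ∈ r, s.1 = EKind.fwd) → Relation.ReflTransGen G.dir a (last ⟨a, r⟩) := by
  intro r
  induction r with
  | nil => intro a _ _; exact Relation.ReflTransGen.refl
  | cons s r ih =>
    intro a hv hf
    rw [valid_cons] at hv
    rw [last_cons]
    have hs := hf s (by simp)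
    have h1 : G.dir a s.2 := by have := hv.1; rw [hs] at this; exact this
    exact Relation.ReflTransGen.head h1 (ih s.2 hv.2 (fun x hx => hf x (by simp [hx])))

theorem rdconn_of_rtg (G : MixedGraph V) {a m : V} (h : Relation.ReflTransGen G.dir a m) :
    a = m ∨ G.RDConn a m := by
  induction h using Relation.ReflTransGen.head_induction_on with
  | refl => exact Or.inl rfl
  | head h1 _ ih =>
    rename_i a c _
    right
    rcases ih with rfl | ⟨⟨b, r⟩, ⟨⟨_, hv⟩, hh, hl⟩, hf⟩
    · refine ⟨⟨a, [(EKind.fwd, c)]⟩, ⟨⟨by simp, ?_⟩, rfl, rfl⟩, ?_⟩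
      · exact ⟨h1, trivial⟩
      · intro s hs
        simp at hs
        rw [hs]
    · simp only at hh
      subst hh
      refine ⟨⟨a, (EKind.fwd, b) :: r⟩, ⟨⟨by simp, ?_⟩, rfl, ?_⟩, ?_⟩
      · exact ⟨h1, hv⟩
      · rw [last_cons]; exact hl
      · intro s hs
        rcases List.mem_cons.1 hs with rfl | hs
        · rfl
        · exact hf s hs

theorem ed_marg (G : MixedGraph V) (T : Set V) (hT : ∀ u v, G.dir u v → v ∈ T → u ∈ T)
    (x y : V) (e : EKind) : Ed (G.marg T) x e y ↔ x ∈ T ∧ y ∈ T ∧ Ed G x e y := by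
  have hR : ∀ u v, Relation.ReflTransGen G.dir u v → v ∈ T → u ∈ T := by
    intro u v h hv
    induction h using Relation.ReflTransGen.head_induction_on with
    | refl => exact hv
    | head h1 _ ih => exact hT _ _ h1 ih
  have hdir : ∀ x y, (G.marg T).dir x y ↔ x ∈ T ∧ y ∈ T ∧ G.dir x y := by
    intro x y
    constructor
    · rintro ⟨hx, hy, ⟨a, r⟩, ⟨⟨hne, hv⟩, hh, hl⟩, hf, hi⟩
      refine ⟨hx, hy, ?_⟩
      simp only at hh hne hv
      subst hh
      match r, hne, hv, hl, hf, hi with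
      | [s], _, hv, hl, hf, _ =>
        have hs := hf s (by simp)
        rw [last_cons, last_nil] at hl
        subst hl
        have := hv.1
        rw [hs] at this
        exact this
      | s :: t :: r, _, hv, hl, hf, hi =>
        exfalso
        refine hi s.2 (by simp [MWalk.interior]) (hR _ _ (rtg_of_fwd G (t :: r) s.2 hv.2 ?_) ?_)
        · intro x hx
          exact hf x (List.mem_cons_of_mem _ hx)
        · rw [← last_cons a, hl]; exact hy
    · rintro ⟨hx, hy, h⟩
      refine ⟨hx, hy, ⟨x, [(EKind.fwd, y)]⟩, ⟨⟨by simp, ⟨h, trivial⟩⟩, rfl, rfl⟩, ?_, ?_⟩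
      · intro s hs
        simp at hs
        rw [hs]
      · simp [MWalk.interior]
  have hbi : ∀ x y, (G.marg T).bi x y ↔ x ∈ T ∧ y ∈ T ∧ G.bi x y := by
    intro x y
    constructor
    · rintro ⟨hx, hy, ⟨a, w⟩, ⟨⟨hne, hv⟩, hh, hl⟩, ⟨l, b, r, hw, hlb, hb, hrf⟩, hi⟩
      refine ⟨hx, hy, ?_⟩
      simp only at hh hne hv hw
      subst hh
      subst hw
      cases l with
      | cons s l =>
        exfalso
        have hs := hlb s (by simp)
        have h1 := hv.1
        rw [hs] at h1
        refine hi s.2 ?_ (hT _ _ h1 hx)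
        cases l <;> simp [MWalk.interior]
      | nil =>
        cases r with
        | nil =>
          rw [List.nil_append, last_cons, last_nil] at hl
          subst hl
          have := hv.1
          rw [hb] at this
          exact this
        | cons t r =>
          exfalso
          refine hi b.2 (by simp [MWalk.interior]) (hR _ _ (rtg_of_fwd G (t :: r) b.2 hv.2 hrf) ?_)
          rw [← last_cons a]
          simp only [List.nil_append] at hl
          rw [hl]; exact hy
    · rintro ⟨hx, hy, h⟩
      refine ⟨hx, hy, ⟨x, [(EKind.bidir, y)]⟩, ⟨⟨by simp, ⟨h, trivial⟩⟩, rfl, rfl⟩, ?_, ?_⟩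
      · exact ⟨[], (EKind.bidir, y), [], by simp⟩
      · simp [MWalk.interior]
  cases e with
  | fwd => exact hdir x y
  | bwd => exact (hdir y x).trans (by simp only [Ed]; tauto)
  | bidir => exact hbi x y

/-- Existence of an unblocked walk into `K`, with the arrowhead flag of its first edge. -/
inductive Co (G : MixedGraph V) (K L : Set V) : V → Bool → Prop
  | nil {k : V} (hk : k ∈ K) : Co G K L k false
  | cons {a u : V} {b : Bool} (e : EKind) (he : Ed G a e u) (h : Co G K L u b)
      (hL : (arrowAtEnd e && b) = true ↔ u ∈ L) : Co G K L a (arrowAtStart e)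

theorem co_walk (G : MixedGraph V) (K L : Set V) {a : V} {b : Bool} (h : Co G K L a b) :
    (a ∈ K ∧ b = false) ∨ ∃ s r, Valid G a (s :: r) ∧ last ⟨a, s :: r⟩ ∈ K ∧
      ¬ Blocked ⟨a, s :: r⟩ L ∧ arrowAtStart s.1 = b := by
  induction h with
  | nil hk => exact Or.inl ⟨hk, rfl⟩
  | cons e he _ hL ih =>
    rename_i a u b _
    right
    rcases ih with ⟨hk, rfl⟩ | ⟨s, r, hv, hl, hb, rfl⟩
    · exact ⟨(e, u), [], ⟨he, trivial⟩, hk, nb_single _ _ _, rfl⟩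
    · refine ⟨(e, u), s :: r, ⟨he, hv⟩, ?_, ?_, rfl⟩
      · rw [last_cons]; exact hl
      · rw [nb_cons]; exact ⟨hL, hb⟩

theorem co_flip (G : MixedGraph V) (J K L T : Set V)
    (hT : ∀ v, v ∈ T → ∃ m ∈ J ∪ K ∪ L, Relation.ReflTransGen G.dir v m)
    {v : V} {b : Bool} (hvT : v ∈ T) (hvL : v ∉ L) (h : Co G K L v b) :
    (∃ j ∈ J, ∃ b, Co G K L j b) ∨ Co G K L v false := by
  cases b with
  | false => exact Or.inr h
  | true =>
  by_cases hA : ∃ l ∈ L, Relation.ReflTransGen G.dir v l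
  · right
    obtain ⟨l, hl, hvl⟩ := hA
    clear hvT
    induction hvl using Relation.ReflTransGen.head_induction_on with
    | refl => exact absurd hl hvL
    | head h1 _ ih =>
      rename_i a c _
      have h2 : Co G K L c true :=
        Co.cons EKind.bwd (show Ed G c EKind.bwd a from h1) h (by simp [arrowAtEnd, hvL])
      by_cases hc : c ∈ L
      · exact Co.cons EKind.fwd (show Ed G a EKind.fwd c from h1) h2 (by simp [arrowAtEnd, hc])
      · exact Co.cons EKind.fwd (show Ed G a EKind.fwd c from h1) (ih hc h2)
          (by simp [hc])
  · obtain ⟨m, hm, hvm⟩ := hT v hvT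
    rcases hm with (hm | hm) | hm
    · left
      refine ⟨m, hm, ?_⟩
      clear hvT hvL
      revert hA
      have h' : ∃ b, Co G K L v b := ⟨_, h⟩
      clear h
      revert h'
      induction hvm using Relation.ReflTransGen.head_induction_on with
      | refl => intro h _; exact h
      | head h1 _ ih =>
        rename_i a c _
        rintro ⟨b, h⟩ hA
        have haL : a ∉ L := fun h => hA ⟨a, h, Relation.ReflTransGen.refl⟩
        refine ih ⟨_, Co.cons EKind.bwd (show Ed G c EKind.bwd a from h1) h
          (by simp [arrowAtEnd, haL])⟩ ?_
        rintro ⟨l, hl, hcl⟩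
        exact hA ⟨l, hl, Relation.ReflTransGen.head h1 hcl⟩
    · right
      clear hvT hvL h
      revert hA
      induction hvm using Relation.ReflTransGen.head_induction_on with
      | refl => intro _; exact Co.nil hm
      | head h1 _ ih =>
        rename_i a c _
        intro hA
        have hA' : ¬ ∃ l ∈ L, Relation.ReflTransGen G.dir c l := by
          rintro ⟨l, hl, hcl⟩
          exact hA ⟨l, hl, Relation.ReflTransGen.head h1 hcl⟩
        have hcL : c ∉ L := fun h => hA' ⟨c, h, Relation.ReflTransGen.refl⟩
        exact Co.cons EKind.fwd (show Ed G a EKind.fwd c from h1) (ih hA') (by simp [hcL])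
    · exact absurd ⟨m, hm, hvm⟩ hA

theorem co_cc (G : MixedGraph V) (J K L T : Set V)
    (hT : ∀ v, v ∈ T → ∃ m ∈ J ∪ K ∪ L, Relation.ReflTransGen G.dir v m)
    (hH : ∀ x y e, Ed (G.marg T) x e y ↔ x ∈ T ∧ y ∈ T ∧ Ed G x e y) :
    ∀ (r : List (EKind × V)) (a : V) (s : EKind × V), Valid (G.marg T) a (s :: r) →
      IsColliderConnected ⟨a, s :: r⟩ → last ⟨a, s :: r⟩ ∉ L →
      (∃ b, Co G K L (last ⟨a, s :: r⟩) b) →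
      (∃ j ∈ J, ∃ b, Co G K L j b) ∨ Co G K L a (arrowAtStart s.1) := by
  intro r
  induction r with
  | nil =>
    intro a s hv _ hL hb
    rw [last_cons, last_nil] at hL hb
    obtain ⟨b, hb⟩ := hb
    obtain ⟨_, h2, h3⟩ := (hH _ _ _).1 hv.1
    rcases co_flip G J K L T hT h2 hL hb with h | h
    · exact Or.inl h
    · exact Or.inr (Co.cons s.1 h3 h (by simp [hL]))
  | cons t r ih =>
    intro a s hv hc hL hb
    rw [last_cons] at hL hb
    rw [cc_cons] at hc
    obtain ⟨_, h2, h3⟩ := (hH _ _ _).1 hv.1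
    rcases ih s.2 t hv.2 hc.2 hL hb with h | h
    · exact Or.inl h
    by_cases hs : s.2 ∈ L
    · exact Or.inr (Co.cons s.1 h3 h (by simp [hs, hc.1]))
    · rcases co_flip G J K L T hT h2 hs h with h | h
      · exact Or.inl h
      · exact Or.inr (Co.cons s.1 h3 h (by simp [hs]))

theorem co_path (G : MixedGraph V) (J K L T : Set V)
    (hT : ∀ v, v ∈ T → ∃ m ∈ J ∪ K ∪ L, Relation.ReflTransGen G.dir v m)
    (hH : ∀ x y e, Ed (G.marg T) x e y ↔ x ∈ T ∧ y ∈ T ∧ Ed G x e y)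
    (hKL : Disjoint K L) :
    ∀ (p : List V) (a : V), p.getLastD a ∈ K → List.IsChain (augAdj (G.marg T)) (a :: p) →
      (∀ v ∈ p.dropLast, v ∉ L) →
      (∃ j ∈ J, ∃ b, Co G K L j b) ∨ ∃ b, Co G K L a b := by
  intro p
  induction p with
  | nil =>
    intro a ha _ _
    exact Or.inr ⟨_, Co.nil ha⟩
  | cons c p ih =>
    intro a ha hc hL
    rw [List.getLastD_cons] at ha
    rw [List.isChain_cons_cons] at hc
    have hcL : c ∉ L := by
      cases p with
      | nil => exact fun h => Set.disjoint_left.1 hKL ha h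
      | cons d p => exact hL c (by simp)
    rcases ih c ha hc.2 (by
        intro v hv
        cases p with
        | nil => simp at hv
        | cons d p => exact hL v (by simp at hv ⊢; tauto)) with h | h
    · exact Or.inl h
    obtain ⟨_, ⟨a', r⟩, ⟨⟨hne, hv⟩, hh, hl⟩, hcc⟩ := hc.1
    simp only at hh hne hv
    subst hh
    cases r with
    | nil => exact absurd rfl hne
    | cons s r =>
      subst hl
      rcases co_cc G J K L T hT hH r a' s hv hcc hcL h with h | h
      · exact Or.inl h
      · exact Or.inr ⟨_, h⟩

/-- Collider-connected walks with the arrowhead flag of the first edge. -/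
inductive CC (H : MixedGraph V) : V → V → Bool → Prop
  | single {a v : V} (e : EKind) (he : Ed H a e v) : CC H a v (arrowAtStart e)
  | cons {a u v : V} (e : EKind) (he : Ed H a e u) (ha : arrowAtEnd e = true)
      (h : CC H u v true) : CC H a v (arrowAtStart e)

theorem cc_walk (H : MixedGraph V) {a v : V} {b : Bool} (h : CC H a v b) :
    ∃ s r, Valid H a (s :: r) ∧ last ⟨a, s :: r⟩ = v ∧ IsColliderConnected ⟨a, s :: r⟩ ∧
      arrowAtStart s.1 = b := by
  induction h with
  | single e he =>
    rename_i a v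
    exact ⟨(e, v), [], ⟨he, trivial⟩, rfl, cc_single _ _, rfl⟩
  | cons e he ha _ ih =>
    rename_i a u v _
    obtain ⟨s, r, hv, hl, hc, hs⟩ := ih
    refine ⟨(e, u), s :: r, ⟨he, hv⟩, ?_, ?_, rfl⟩
    · rw [last_cons]; exact hl
    · rw [cc_cons]; exact ⟨⟨ha, hs⟩, hc⟩

theorem anc_start (G : MixedGraph V) (K L T : Set V)
    (hT : ∀ u v, G.dir u v → v ∈ T → u ∈ T) (hK : K ⊆ T) (hLT : L ⊆ T) :
    ∀ (r : List (EKind × V)) (a : V) (s : EKind × V), Valid G a (s :: r) →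
      ¬ Blocked ⟨a, s :: r⟩ L → last ⟨a, s :: r⟩ ∈ K → arrowAtStart s.1 = false → a ∈ T := by
  intro r
  induction r with
  | nil =>
    rintro a ⟨e, u⟩ hv _ hl hs
    cases e <;> simp [arrowAtStart] at hs
    exact hT _ _ hv.1 (hK hl)
  | cons t r ih =>
    rintro a ⟨e, u⟩ hv hb hl hs
    cases e <;> simp [arrowAtStart] at hs
    refine hT _ _ hv.1 ?_
    rw [nb_cons] at hb
    rw [last_cons] at hl
    by_cases ht : arrowAtStart t.1 = true
    · exact hLT (hb.1.1 (by simp [arrowAtEnd, ht]))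
    · exact ih u t hv.2 hb.2 hl (by simpa using ht)

theorem fwd_main (G : MixedGraph V) (K L T : Set V)
    (hT : ∀ u v, G.dir u v → v ∈ T → u ∈ T) (hK : K ⊆ T) (hLT : L ⊆ T)
    (hKL : Disjoint K L) :
    ∀ (r : List (EKind × V)) (a : V) (s : EKind × V), Valid G a (s :: r) →
      ¬ Blocked ⟨a, s :: r⟩ L → last ⟨a, s :: r⟩ ∈ K → a ∈ T →
      ∃ v, v ∉ L ∧ CC (G.marg T) a v (arrowAtStart s.1) ∧
        Relation.ReflTransGen (fun x y => y ∉ L ∧ ∃ b, CC (G.marg T) x y b) v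
          (last ⟨a, s :: r⟩) := by
  intro r
  induction r with
  | nil =>
    rintro a s hv _ hl ha
    rw [last_cons, last_nil] at hl ⊢
    exact ⟨s.2, Set.disjoint_left.1 hKL hl,
      CC.single s.1 ((ed_marg G T hT _ _ _).2 ⟨ha, hK hl, hv.1⟩), Relation.ReflTransGen.refl⟩
  | cons t r ih =>
    rintro a s hv hb hl ha
    rw [nb_cons] at hb
    rw [last_cons] at hl ⊢
    have hu : s.2 ∈ T := by
      by_cases ht : arrowAtStart t.1 = true
      · by_cases hs : arrowAtEnd s.1 = true
        · exact hLT (hb.1.1 (by simp [hs, ht]))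
        · obtain ⟨e, u⟩ := s
          cases e <;> simp [arrowAtEnd] at hs
          exact hT _ _ hv.1 ha
      · exact anc_start G K L T hT hK hLT r s.2 t hv.2 hb.2 hl (by simpa using ht)
    have he : Ed (G.marg T) a s.1 s.2 := (ed_marg G T hT _ _ _).2 ⟨ha, hu, hv.1⟩
    obtain ⟨v, hvL, hcc, hR⟩ := ih s.2 t hv.2 hb.2 hl hu
    by_cases hs : s.2 ∈ L
    · have h := hb.1.2 hs
      rw [Bool.and_eq_true] at h
      rw [h.2] at hcc
      exact ⟨v, hvL, CC.cons s.1 he h.1 hcc, hR⟩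
    · exact ⟨s.2, hs, CC.single s.1 he, Relation.ReflTransGen.head ⟨hvL, _, hcc⟩ hR⟩

theorem nodup_path {R : V → V → Prop} {a k : V} (h : Relation.ReflTransGen R a k) :
    ∃ p : List V, p.getLastD a = k ∧ (a :: p).Nodup ∧ List.IsChain R (a :: p) := by
  induction h using Relation.ReflTransGen.head_induction_on with
  | refl => exact ⟨[], rfl, by simp, by simp⟩
  | head h1 _ ih =>
    rename_i a c _
    obtain ⟨p, hl, hn, hc⟩ := ih
    by_cases ha : a ∈ c :: p
    · obtain ⟨s, t, hst⟩ := List.append_of_mem ha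
      refine ⟨t, ?_, ?_, ?_⟩
      · rw [← hl]
        have h2 : (c :: p).getLast? = (s ++ a :: t).getLast? := by rw [hst]
        simpa [List.getLast?_cons, List.getLast?_append] using h2.symm
      · rw [hst] at hn
        exact (List.nodup_append.1 hn).2.1
      · rw [hst] at hc
        exact (List.isChain_append.1 hc).2.1
    · exact ⟨c :: p, by rw [List.getLastD_cons]; exact hl, List.nodup_cons.2 ⟨ha, hn⟩,
        List.isChain_cons_cons.2 ⟨h1, hc⟩⟩

theorem chain_mem {R : V → V → Prop} {P : V → Prop} : ∀ (p : List V) (a : V),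
    List.IsChain (fun x y => R x y ∧ P y) (a :: p) → List.IsChain R (a :: p) ∧ ∀ v ∈ p, P v := by
  intro p
  induction p with
  | nil => intro a _; simp
  | cons c p ih =>
    intro a h
    rw [List.isChain_cons_cons] at h
    obtain ⟨h1, h2⟩ := ih c h.2
    refine ⟨List.isChain_cons_cons.2 ⟨h.1.1, h1⟩, ?_⟩
    intro v hv
    rcases List.mem_cons.1 hv with rfl | hv
    · exact h.1.2
    · exact h2 v hv

end AugHelpers

/-- The augmentation criterion for m-separation: with `T` the ancestral closure
of `J ∪ K ∪ L`, m-connection between `J` and `K` given `L` in `G` is equivalent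
to the existence of a path from `J` to `K` avoiding `L` in the augmented
undirected graph of the marginal graph on `T`. -/
theorem augmentation_criterion {V : Type*} (G : MixedGraph V) (hsymm : G.BiSymm)
    (hcan : G.Canonical) (J K L : Set V)
    (hJK : Disjoint J K) (hJL : Disjoint J L) (hKL : Disjoint K L) :
    ∀ T : Set V,
      T = (J ∪ K ∪ L) ∪ {v : V | ∃ m ∈ J ∪ K ∪ L, G.RDConn v m} →
      ((∃ j ∈ J, ∃ k ∈ K, G.MConn j k L) ↔
        ∃ (a : V) (p : List V), a ∈ J ∧ p.getLastD a ∈ K ∧ (a :: p).Nodup ∧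
          List.Chain (augAdj (G.marg T)) a p ∧ ∀ v ∈ p.dropLast, v ∉ L) := by
  intro T hTdef
  have hTiff : ∀ v, v ∈ T ↔ ∃ m ∈ J ∪ K ∪ L, Relation.ReflTransGen G.dir v m := by
    intro v
    rw [hTdef]
    constructor
    · rintro (h | ⟨m, hm, ⟨x, r⟩, ⟨⟨_, hv⟩, hh, hl⟩, hf⟩)
      · exact ⟨v, h, Relation.ReflTransGen.refl⟩
      · simp only at hh
        subst hh
        refine ⟨m, hm, ?_⟩
        rw [← hl]
        exact rtg_of_fwd G r x hv hf
    · rintro ⟨m, hm, h⟩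
      rcases rdconn_of_rtg G h with rfl | h
      · exact Or.inl hm
      · exact Or.inr ⟨m, hm, h⟩
  have hT : ∀ u v, G.dir u v → v ∈ T → u ∈ T := by
    intro u v huv hv
    obtain ⟨m, hm, h⟩ := (hTiff v).1 hv
    exact (hTiff u).2 ⟨m, hm, Relation.ReflTransGen.head huv h⟩
  have hsub : ∀ v ∈ J ∪ K ∪ L, v ∈ T := fun v hv =>
    (hTiff v).2 ⟨v, hv, Relation.ReflTransGen.refl⟩
  have hH := fun x y e => ed_marg G T hT x y e
  constructor
  · rintro ⟨j, hj, k, hk, ⟨x, r⟩, ⟨⟨hne, hv⟩, hh, hl⟩, hb⟩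
    simp only at hh hne hv
    subst hh
    cases r with
    | nil => exact absurd rfl hne
    | cons s r =>
      subst hl
      obtain ⟨v, hvL, hcc, hR⟩ := fwd_main G K L T hT
        (fun v hv => hsub v (Or.inl (Or.inr hv))) (fun v hv => hsub v (Or.inr hv)) hKL
        r x s hv hb hk (hsub x (Or.inl (Or.inl hj)))
      have hR' := Relation.ReflTransGen.head (r := fun x y => y ∉ L ∧
        ∃ b, CC (G.marg T) x y b) ⟨hvL, _, hcc⟩ hR
      have hR2 : Relation.ReflTransGen (fun x y => augAdj (G.marg T) x y ∧ y ∉ L) x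
          (MWalk.last ⟨x, s :: r⟩) := by
        clear hv hb hvL hcc hR hj hk hne
        generalize MWalk.last ⟨x, s :: r⟩ = k at hR'
        induction hR' with
        | refl => exact Relation.ReflTransGen.refl
        | tail _ h2 ih =>
          rename_i y z _
          by_cases hyz : y = z
          · exact hyz ▸ ih
          · obtain ⟨hz, b, hcc⟩ := h2
            obtain ⟨s', r', h1, h2, h3, _⟩ := cc_walk _ hcc
            exact ih.tail ⟨⟨hyz, ⟨y, s' :: r'⟩, ⟨⟨by simp, h1⟩, rfl, h2⟩, h3⟩, hz⟩
      obtain ⟨p, hpl, hpn, hpc⟩ := nodup_path hR2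
      obtain ⟨h1, h2⟩ := chain_mem p x hpc
      exact ⟨x, p, hj, by rw [hpl]; exact hk, hpn, h1,
        fun v hv => h2 v (List.mem_of_mem_dropLast hv)⟩
  · rintro ⟨a, p, ha, hpK, _, hc, hL⟩
    have hdone : ∃ j ∈ J, ∃ b, Co G K L j b := by
      rcases co_path G J K L T (fun v hv => (hTiff v).1 hv) hH hKL p a hpK hc hL with h | h
      · exact h
      · exact ⟨a, ha, h⟩
    obtain ⟨j, hj, b, hb⟩ := hdone
    rcases co_walk G K L hb with ⟨h, _⟩ | ⟨s, r, hv, hl, hb, _⟩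
    · exact absurd h (Set.disjoint_left.1 hJK hj)
    · exact ⟨j, hj, _, hl, ⟨j, s :: r⟩, ⟨⟨by simp, hv⟩, rfl, rfl⟩, hb⟩
end
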